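/- Min-based altruistic-treatment preferences are type-II-monotonic: let G be a network of friends on N = {1,…,n} with M ≥ n³, let i ∈ N, let j ∈ E_i, let Γ, Δ be coalition structures on N with j ∈ Γ(i) \ Δ(i) and v_j(Γ) ≥ v_j(Δ), and let G' be the graph obtained from G by adding the edge {i,j}; write u' for the min-based altruistic-treatment utility in G'. Then u^minAL_i(Γ) ≥ u^minAL_i(Δ) implies u'^minAL_i(Γ) > u'^minAL_i(Δ). -/

import Mathlib

namespace ACFG

/-- A coalition structure on the player set `Fin n` (the players `1,…,n`), represented by
the map sending each player to her coalition (her block of the partition). -/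
structure CoalitionStructure (n : ℕ) where
  block : Fin n → Finset (Fin n)
  mem_block : ∀ i, i ∈ block i
  block_eq : ∀ i j, j ∈ block i → block j = block i

variable {n : ℕ}

/-- The set `F_i` of friends of player `i` in the network of friends `G`. -/
def friends (G : SimpleGraph (Fin n)) [DecidableRel G.Adj] (i : Fin n) : Finset (Fin n) :=
  Finset.univ.filter (fun j => G.Adj i j)

/-- The set `E_i` of enemies of player `i`: all players other than `i` and her friends. -/
def enemies (G : SimpleGraph (Fin n)) [DecidableRel G.Adj] (i : Fin n) : Finset (Fin n) :=
  (insert i (friends G i))ᶜ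

/-- The friend-oriented value of player `i` for the coalition structure `Γ`:
`v_i(Γ) = n·|Γ(i) ∩ F_i| − |Γ(i) ∩ E_i|`. -/
def val (G : SimpleGraph (Fin n)) [DecidableRel G.Adj] (Γ : CoalitionStructure n)
    (i : Fin n) : ℤ :=
  (n : ℤ) * ((Γ.block i ∩ friends G i).card : ℤ) - ((Γ.block i ∩ enemies G i).card : ℤ)

/-- `sumF_i(Γ)`: the sum of the values of `i`'s friends. -/
def sumF (G : SimpleGraph (Fin n)) [DecidableRel G.Adj] (Γ : CoalitionStructure n)
    (i : Fin n) : ℤ :=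
  ∑ f ∈ friends G i, val G Γ f

/-- `sumF+_i(Γ)`: the sum of the values of `i`'s friends and of `i` herself. -/
def sumFplus (G : SimpleGraph (Fin n)) [DecidableRel G.Adj] (Γ : CoalitionStructure n)
    (i : Fin n) : ℤ :=
  ∑ f ∈ insert i (friends G i), val G Γ f

/-- `minF_i(Γ)`: the minimum of the values of `i`'s friends (`0` if `i` has no friends). -/
def minF (G : SimpleGraph (Fin n)) [DecidableRel G.Adj] (Γ : CoalitionStructure n)
    (i : Fin n) : ℤ :=
  if h : (friends G i).Nonempty then (friends G i).inf' h (val G Γ) else 0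

/-- `minF+_i(Γ)`: the minimum of the values of `i`'s friends and of `i` herself. -/
def minFplus (G : SimpleGraph (Fin n)) [DecidableRel G.Adj] (Γ : CoalitionStructure n)
    (i : Fin n) : ℤ :=
  (insert i (friends G i)).inf' (Finset.insert_nonempty _ _) (val G Γ)

/-- Sum-based selfish-first utility: `u^sumSF_i(Γ) = M·v_i(Γ) + sumF_i(Γ)`. -/
def usumSF (G : SimpleGraph (Fin n)) [DecidableRel G.Adj] (M : ℤ) (Γ : CoalitionStructure n)
    (i : Fin n) : ℤ :=
  M * val G Γ i + sumF G Γ i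

/-- Sum-based equal-treatment utility: `u^sumEQ_i(Γ) = sumF+_i(Γ)`. -/
def usumEQ (G : SimpleGraph (Fin n)) [DecidableRel G.Adj] (Γ : CoalitionStructure n)
    (i : Fin n) : ℤ :=
  sumFplus G Γ i

/-- Sum-based altruistic-treatment utility: `u^sumAL_i(Γ) = v_i(Γ) + M·sumF_i(Γ)`. -/
def usumAL (G : SimpleGraph (Fin n)) [DecidableRel G.Adj] (M : ℤ) (Γ : CoalitionStructure n)
    (i : Fin n) : ℤ :=
  val G Γ i + M * sumF G Γ i

/-- Min-based selfish-first utility: `u^minSF_i(Γ) = M·v_i(Γ) + minF_i(Γ)`. -/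
def uminSF (G : SimpleGraph (Fin n)) [DecidableRel G.Adj] (M : ℤ) (Γ : CoalitionStructure n)
    (i : Fin n) : ℤ :=
  M * val G Γ i + minF G Γ i

/-- Min-based equal-treatment utility: `u^minEQ_i(Γ) = minF+_i(Γ)`. -/
def uminEQ (G : SimpleGraph (Fin n)) [DecidableRel G.Adj] (Γ : CoalitionStructure n)
    (i : Fin n) : ℤ :=
  minFplus G Γ i

/-- Min-based altruistic-treatment utility: `u^minAL_i(Γ) = v_i(Γ) + M·minF_i(Γ)`. -/
def uminAL (G : SimpleGraph (Fin n)) [DecidableRel G.Adj] (M : ℤ) (Γ : CoalitionStructure n)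
    (i : Fin n) : ℤ :=
  val G Γ i + M * minF G Γ i

/-- The graph `G'` obtained from `G` by adding the edge `{i, j}`. -/
def addEdge (G : SimpleGraph (Fin n)) (i j : Fin n) : SimpleGraph (Fin n) :=
  G ⊔ SimpleGraph.fromEdgeSet {s(i, j)}

instance (G : SimpleGraph (Fin n)) [DecidableRel G.Adj] (i j : Fin n) :
    DecidableRel (addEdge G i j).Adj := fun a b =>
  decidable_of_iff (G.Adj a b ∨ (s(a, b) = s(i, j) ∧ a ≠ b)) (by
    simp [addEdge, SimpleGraph.fromEdgeSet_adj])

theorem mem_friends (G : SimpleGraph (Fin n)) [DecidableRel G.Adj] (i k : Fin n) :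
    k ∈ friends G i ↔ G.Adj i k := by
  simp [friends]

theorem mem_enemies (G : SimpleGraph (Fin n)) [DecidableRel G.Adj] (i k : Fin n) :
    k ∈ enemies G i ↔ k ≠ i ∧ ¬ G.Adj i k := by
  simp [enemies, mem_friends]

theorem val_le (G : SimpleGraph (Fin n)) [DecidableRel G.Adj] (Γ : CoalitionStructure n)
    (i : Fin n) : val G Γ i ≤ n * (n - 1) := by
  have h : (Γ.block i ∩ friends G i).card < n := by
    simpa using Finset.card_lt_univ_of_notMem
      (show i ∉ Γ.block i ∩ friends G i by simp [mem_friends])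
  have h' : ((Γ.block i ∩ friends G i).card : ℤ) ≤ n - 1 := by omega
  have := mul_le_mul_of_nonneg_left h' (Int.natCast_nonneg n)
  unfold val
  omega

theorem neg_lt_val (G : SimpleGraph (Fin n)) [DecidableRel G.Adj] (Γ : CoalitionStructure n)
    (i : Fin n) : -(n : ℤ) < val G Γ i := by
  have h : (Γ.block i ∩ enemies G i).card < n := by
    simpa using Finset.card_lt_univ_of_notMem
      (show i ∉ Γ.block i ∩ enemies G i by simp [mem_enemies])
  have : (0 : ℤ) ≤ n * ((Γ.block i ∩ friends G i).card : ℤ) := by positivity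
  unfold val
  omega

theorem val_sub_val_lt (G : SimpleGraph (Fin n)) [DecidableRel G.Adj]
    (Γ Δ : CoalitionStructure n) (i k : Fin n) : val G Γ i - val G Δ k < (n : ℤ) ^ 3 := by
  have h₁ := val_le G Γ i
  have h₂ := neg_lt_val G Δ k
  have hn : (1 : ℤ) ≤ n := by exact_mod_cast i.pos
  have : (n : ℤ) ^ 2 ≤ (n : ℤ) ^ 3 := pow_le_pow_right₀ hn (by norm_num)
  linarith

theorem val_congr {G G' : SimpleGraph (Fin n)} [DecidableRel G.Adj] [DecidableRel G'.Adj]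
    {k : Fin n} (h : friends G' k = friends G k) (Γ : CoalitionStructure n) :
    val G' Γ k = val G Γ k := by
  simp [val, enemies, h]

theorem val_of_friends_eq_insert {G G' : SimpleGraph (Fin n)} [DecidableRel G.Adj]
    [DecidableRel G'.Adj] {k l : Fin n} (hl : l ∈ enemies G k)
    (h : friends G' k = insert l (friends G k)) (Γ : CoalitionStructure n) :
    val G' Γ k = val G Γ k + if l ∈ Γ.block k then (n : ℤ) + 1 else 0 := by
  have hF : l ∉ friends G k := by
    rw [mem_friends]
    exact ((mem_enemies G k l).1 hl).2
  have hE : enemies G' k = (enemies G k).erase l := by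
    ext x
    simp only [enemies, h, Finset.mem_compl, Finset.mem_insert, Finset.mem_erase]
    tauto
  split_ifs with hΓ
  · have hmem : l ∈ Γ.block k ∩ enemies G k := Finset.mem_inter.2 ⟨hΓ, hl⟩
    have hcard := Finset.card_erase_add_one hmem
    rw [val, val, hE, h, Finset.inter_insert_of_mem hΓ,
      Finset.card_insert_of_notMem (by simp [hF]), Finset.inter_erase, ← hcard]
    push_cast
    ring
  · rw [val, val, hE, h, Finset.inter_insert_of_notMem hΓ, Finset.inter_erase,
      Finset.erase_eq_of_notMem (by simp [hΓ]), add_zero]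

theorem addEdge_adj (G : SimpleGraph (Fin n)) (i j a b : Fin n) :
    (addEdge G i j).Adj a b ↔ G.Adj a b ∨ ((a = i ∧ b = j ∨ a = j ∧ b = i) ∧ a ≠ b) := by
  simp [addEdge]

theorem friends_addEdge_left (G : SimpleGraph (Fin n)) [DecidableRel G.Adj] {i j : Fin n}
    (hij : i ≠ j) : friends (addEdge G i j) i = insert j (friends G i) := by
  ext x
  simp only [mem_friends, Finset.mem_insert, addEdge_adj]
  grind

theorem friends_addEdge_right (G : SimpleGraph (Fin n)) [DecidableRel G.Adj] {i j : Fin n}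
    (hij : i ≠ j) : friends (addEdge G i j) j = insert i (friends G j) := by
  ext x
  simp only [mem_friends, Finset.mem_insert, addEdge_adj]
  grind

theorem friends_addEdge_of_ne (G : SimpleGraph (Fin n)) [DecidableRel G.Adj] {i j k : Fin n}
    (hi : k ≠ i) (hj : k ≠ j) : friends (addEdge G i j) k = friends G k := by
  ext x
  simp [mem_friends, addEdge_adj, hi, hj]

theorem minF_addEdge (G : SimpleGraph (Fin n)) [DecidableRel G.Adj] {i j : Fin n}
    (hj : j ∈ enemies G i) (Γ : CoalitionStructure n) :
    minF (addEdge G i j) Γ i = if (friends G i).Nonempty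
      then min (val (addEdge G i j) Γ j) (minF G Γ i) else val (addEdge G i j) Γ j := by
  obtain ⟨hji, hadj⟩ := (mem_enemies G i j).1 hj
  have hval : ∀ k ∈ friends G i, val (addEdge G i j) Γ k = val G Γ k := by
    intro k hk
    rw [mem_friends] at hk
    refine val_congr (friends_addEdge_of_ne G hk.ne' ?_) Γ
    rintro rfl
    exact hadj hk
  simp only [minF, friends_addEdge_left G hji.symm, Finset.insert_nonempty, dite_true]
  split_ifs with hF
  · rw [Finset.inf'_insert hF, Finset.inf'_congr hF rfl hval]
  · simp [Finset.not_nonempty_iff_eq_empty.1 hF]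

theorem CoalitionStructure.mem_block_comm (Γ : CoalitionStructure n) {i j : Fin n} :
    j ∈ Γ.block i ↔ i ∈ Γ.block j :=
  ⟨fun h => Γ.block_eq i j h ▸ Γ.mem_block i, fun h => Γ.block_eq j i h ▸ Γ.mem_block j⟩

/-- Min-based altruistic-treatment preferences are type-II-monotonic:
if the enemy `j` of `i` satisfies `j ∈ Γ(i) \ Δ(i)` and `v_j(Γ) ≥ v_j(Δ)`, then turning
`j` into a friend of `i` turns `i`'s weak preference of `Γ` over `Δ` into a strict one
(for `M ≥ n³`). -/
theorem minAL_typeII_monotonic (G : SimpleGraph (Fin n)) [DecidableRel G.Adj] (M : ℤ)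
    (hM : (n : ℤ) ^ 3 ≤ M) (i j : Fin n) (hj : j ∈ enemies G i)
    (Γ Δ : CoalitionStructure n) (hv : val G Δ j ≤ val G Γ j)
    (hcase : j ∈ Γ.block i ∧ j ∉ Δ.block i) :
    uminAL G M Δ i ≤ uminAL G M Γ i →
      uminAL (addEdge G i j) M Δ i < uminAL (addEdge G i j) M Γ i := by
  intro hu
  obtain ⟨hΓ, hΔ⟩ := hcase
  obtain ⟨hji, hadj⟩ := (mem_enemies G i j).1 hj
  have hi : i ∈ enemies G j := (mem_enemies G j i).2 ⟨hji.symm, fun h => hadj h.symm⟩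
  have hvi := val_of_friends_eq_insert hj (friends_addEdge_left G hji.symm)
  have hvj := val_of_friends_eq_insert hi (friends_addEdge_right G hji.symm)
  have hΓ' := Γ.mem_block_comm.1 hΓ
  have hΔ' := mt Δ.mem_block_comm.2 hΔ
  have hlt := (val_sub_val_lt G Γ Δ i i).trans_le hM
  have hgt := (val_sub_val_lt G Δ Γ i i).trans_le hM
  have hM₀ : 0 ≤ M := le_trans (by positivity) hM
  have hn : (0 : ℤ) ≤ n := Int.natCast_nonneg n
  have gain : ∀ {a b : ℤ}, a < b → M * a + M ≤ M * b := fun {a b} hab => by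
    nlinarith [mul_le_mul_of_nonneg_left (Int.add_one_le_of_lt hab) hM₀]
  have hmin : minF G Δ i ≤ minF G Γ i := by
    by_contra! h
    have := gain h
    unfold uminAL at hu
    linarith
  unfold uminAL at hu ⊢
  rw [minF_addEdge G hj, minF_addEdge G hj, hvi, hvi, hvj, hvj, if_pos hΓ, if_neg hΔ,
    if_pos hΓ', if_neg hΔ', add_zero, add_zero]
  split_ifs
  · rcases hmin.eq_or_lt with heq | hlt'
    · rw [heq] at hu ⊢
      have : min (val G Δ j) (minF G Γ i) ≤ min (val G Γ j + (n + 1)) (minF G Γ i) :=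
        min_le_min_right _ (by linarith)
      have := mul_le_mul_of_nonneg_left this hM₀
      linarith
    · have : min (val G Δ j) (minF G Δ i) < min (val G Γ j + (n + 1)) (minF G Γ i) :=
        min_lt_min (by linarith) hlt'
      have := gain this
      linarith
  · have := gain (show val G Δ j < val G Γ j + (n + 1) by linarith)
    linarith

end ACFG
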